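/- arXiv:2011.06196 — 3 statements merged into one kernel-verified Lean document; each statement's English description precedes it below -/
import Mathlib

section
/- Let X be a compact metric space, f : X → X continuous, and φ : X → ℝ continuous. If ∫ φ dμ < λ for every f-invariant Borel probability measure μ, then for every x ∈ X there exists a positive integer n(x) such that (1/n(x)) · Σ_{i=0}^{n(x)-1} φ(f^i(x)) < λ. -/
open MeasureTheory Filter Topology

/-- The empirical measure of the first `n + 1` points of the orbit of `x` under `f`. -/
noncomputable def empiricalMeasure {X : Type*} [MeasurableSpace X] (f : X → X) (x : X) (n : ℕ) :
    Measure X :=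
  ((n + 1 : ℕ) : ENNReal)⁻¹ • ∑ i ∈ Finset.range (n + 1), Measure.dirac (f^[i] x)

instance isProbabilityMeasure_empiricalMeasure {X : Type*} [MeasurableSpace X] (f : X → X) (x : X)
    (n : ℕ) : IsProbabilityMeasure (empiricalMeasure f x n) := by
  constructor
  simp only [empiricalMeasure, Measure.smul_apply, Measure.finsetSum_apply, measure_univ,
    Finset.sum_const, Finset.card_range, smul_eq_mul, nsmul_eq_mul, mul_one]
  exact ENNReal.inv_mul_cancel (by simp) (by simp)

theorem integral_empiricalMeasure {X : Type*} [TopologicalSpace X] [CompactSpace X]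
    [MeasurableSpace X] [BorelSpace X] (f : X → X) (x : X) (n : ℕ) {g : X → ℝ}
    (hg : Continuous g) :
    ∫ y, g y ∂(empiricalMeasure f x n) = birkhoffAverage ℝ f g (n + 1) x := by
  have hint (i : ℕ) : Integrable g (Measure.dirac (f^[i] x)) :=
    hg.integrable_of_hasCompactSupport (HasCompactSupport.of_compactSpace g)
  rw [empiricalMeasure, integral_smul_measure, integral_finsetSum_measure fun i _ ↦ hint i,
    ENNReal.toReal_inv, ENNReal.toReal_natCast]
  simp [birkhoffAverage, birkhoffSum, integral_dirac' _ _ hg.stronglyMeasurable]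

/-- **Krylov–Bogolyubov**: along a nontrivial filter, the Birkhoff averages of all continuous
functions at `x` converge to their integrals against some invariant probability measure. -/
theorem exists_invariant_measure_tendsto_birkhoffAverage {X : Type*} [MetricSpace X]
    [CompactSpace X] [MeasurableSpace X] [BorelSpace X] {f : X → X} (hf : Continuous f) (x : X) :
    ∃ μ : Measure X, IsProbabilityMeasure μ ∧ μ.map f = μ ∧
      ∀ g : X → ℝ, Continuous g →
        Tendsto (fun n ↦ birkhoffAverage ℝ f g (n + 1) x) (hyperfilter ℕ) (𝓝 (∫ y, g y ∂μ)) := by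
  let ν : ℕ → ProbabilityMeasure X := fun n ↦ ⟨empiricalMeasure f x n, inferInstance⟩
  obtain ⟨μ, -, hμ⟩ := isCompact_univ.ultrafilter_le_nhds ((hyperfilter ℕ).map ν) (by simp)
  have key (g : X → ℝ) (hg : Continuous g) :
      Tendsto (fun n ↦ birkhoffAverage ℝ f g (n + 1) x) (hyperfilter ℕ)
        (𝓝 (∫ y, g y ∂(μ : Measure X))) := by
    have := ProbabilityMeasure.tendsto_iff_forall_integral_tendsto.1
      (show Tendsto ν (hyperfilter ℕ) (𝓝 μ) from hμ) (BoundedContinuousFunction.mkOfCompact ⟨g, hg⟩)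
    simpa [ν, integral_empiricalMeasure f x _ hg] using this
  refine ⟨μ, inferInstance, ?_, key⟩
  have := Measure.isProbabilityMeasure_map (μ := (μ : Measure X)) hf.aemeasurable
  refine ext_of_forall_integral_eq_of_IsFiniteMeasure fun g ↦ ?_
  rw [integral_map hf.aemeasurable g.continuous.aestronglyMeasurable]
  have hdiff := (key (g ∘ f) (g.continuous.comp hf)).sub (key g g.continuous)
  have hzero := ((tendsto_birkhoffAverage_apply_sub_birkhoffAverage' ℝ g.isBounded_range f x).comp
    (tendsto_add_atTop_nat 1)).mono_left (Nat.hyperfilter_le_atTop)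
  refine sub_eq_zero.1 (tendsto_nhds_unique hdiff (hzero.congr fun n ↦ ?_))
  simp [birkhoffAverage, birkhoffSum, ← Function.iterate_succ_apply, Function.iterate_succ_apply']

/-- If the integral of a continuous function `φ` is `< λ` for every `f`-invariant
Borel probability measure on a compact metric space, then for every point `x`
there is a positive integer `n` whose Birkhoff average at `x` is `< λ`. -/
theorem stmt_0 {X : Type*} [MetricSpace X] [CompactSpace X]
    [MeasurableSpace X] [BorelSpace X]
    (f : X → X) (hf : Continuous f) (φ : X → ℝ) (hφ : Continuous φ) (lam : ℝ)
    (h : ∀ μ : Measure X, IsProbabilityMeasure μ → Measure.map f μ = μ →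
      ∫ x, φ x ∂μ < lam) :
    ∀ x : X, ∃ n : ℕ, 0 < n ∧
      (1 / (n : ℝ)) * ∑ i ∈ Finset.range n, φ (f^[i] x) < lam := by
  intro x
  obtain ⟨μ, hμ, hinv, hlim⟩ := exists_invariant_measure_tendsto_birkhoffAverage hf x
  obtain ⟨n, hn⟩ := ((hlim φ hφ).eventually_lt_const (h μ hμ hinv)).exists
  exact ⟨n + 1, n.succ_pos, by simpa [birkhoffAverage, birkhoffSum] using hn⟩
end

section
/- Let X be a compact metric space, f : X → X continuous, and φ : X → ℝ continuous. If ∫ φ dμ < λ for every f-invariant Borel probability measure μ, then there exists a positive integer N such that for all n ≥ N and all x ∈ X, (1/n) · Σ_{i=0}^{n-1} φ(f^i(x)) < λ. -/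
open MeasureTheory Filter Topology BoundedContinuousFunction

/-- The uniform probability measure on the first `n + 1` points of the `f`-orbit of `x`. -/
noncomputable def orbitMeasure {X : Type*} [MeasurableSpace X] (f : X → X) (n : ℕ) (x : X) :
    ProbabilityMeasure X :=
  ⟨((n + 1 : ℕ) : ENNReal)⁻¹ • ∑ i ∈ Finset.range (n + 1), Measure.dirac (f^[i] x), ⟨by
    simpa using ENNReal.inv_mul_cancel (a := ((n + 1 : ℕ) : ENNReal))
      (by simp) (ENNReal.natCast_ne_top _)⟩⟩

theorem integral_orbitMeasure {X : Type*} [TopologicalSpace X] [MeasurableSpace X]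
    [OpensMeasurableSpace X] (f : X → X) (n : ℕ) (x : X) (g : X →ᵇ ℝ) :
    ∫ y, g y ∂(orbitMeasure f n x : Measure X) = birkhoffAverage ℝ f g (n + 1) x := by
  have hg : StronglyMeasurable g := g.continuous.measurable.stronglyMeasurable
  simp only [orbitMeasure, ProbabilityMeasure.coe_mk]
  rw [integral_smul_measure, integral_finsetSum_measure fun i _ ↦ g.integrable _]
  simp only [integral_dirac' _ _ hg, birkhoffAverage, birkhoffSum, ENNReal.toReal_inv,
    ENNReal.toReal_natCast]

/-- **Krylov–Bogolyubov**: a weak limit of uniform measures on longer and longer orbit segments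
of a continuous map is invariant. -/
theorem map_eq_of_tendsto_orbitMeasure {X ι : Type*} [TopologicalSpace X] [HasOuterApproxClosed X]
    [MeasurableSpace X] [BorelSpace X] {f : X → X} (hf : Continuous f) {l : Filter ι} [l.NeBot]
    {n : ι → ℕ} {x : ι → X} (hn : Tendsto n l atTop) {μ : ProbabilityMeasure X}
    (hμ : Tendsto (fun k ↦ orbitMeasure f (n k) (x k)) l (𝓝 μ)) :
    Measure.map f (μ : Measure X) = μ := by
  have : IsProbabilityMeasure (Measure.map f (μ : Measure X)) :=
    Measure.isProbabilityMeasure_map hf.aemeasurable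
  rw [ProbabilityMeasure.tendsto_iff_forall_integral_tendsto] at hμ
  refine ext_of_forall_integral_eq_of_IsFiniteMeasure fun g ↦ ?_
  rw [integral_map hf.aemeasurable g.continuous.aestronglyMeasurable]
  have hsub := (hμ (g.compContinuous ⟨f, hf⟩)).sub (hμ g)
  simp only [integral_orbitMeasure] at hsub
  refine sub_eq_zero.1 (tendsto_nhds_unique hsub ?_)
  have hbound : Tendsto (fun k ↦ 2 * ‖g‖ / ((n k + 1 : ℕ) : ℝ)) l (𝓝 0) :=
    tendsto_const_nhds.div_atTop
      (tendsto_natCast_atTop_atTop.comp ((tendsto_add_atTop_nat 1).comp hn))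
  refine squeeze_zero_norm (fun k ↦ ?_) hbound
  have hshift : birkhoffAverage ℝ f (g.compContinuous ⟨f, hf⟩) (n k + 1) (x k) =
      birkhoffAverage ℝ f g (n k + 1) (f (x k)) := by
    simp only [birkhoffAverage, birkhoffSum, compContinuous_apply, ContinuousMap.coe_mk,
      ← Function.iterate_succ_apply, Function.iterate_succ_apply']
  rw [hshift, ← dist_eq_norm, dist_birkhoffAverage_apply_birkhoffAverage]
  gcongr
  exact g.dist_le_two_norm _ _

/-- If the integral of a continuous function `φ` is `< λ` for every `f`-invariant
Borel probability measure on a compact metric space, then there is a positive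
integer `N` such that all Birkhoff averages of length `n ≥ N` are `< λ`,
uniformly in the starting point. -/
theorem stmt_1 {X : Type*} [MetricSpace X] [CompactSpace X]
    [MeasurableSpace X] [BorelSpace X]
    (f : X → X) (hf : Continuous f) (φ : X → ℝ) (hφ : Continuous φ) (lam : ℝ)
    (h : ∀ μ : Measure X, IsProbabilityMeasure μ → Measure.map f μ = μ →
      ∫ x, φ x ∂μ < lam) :
    ∃ N : ℕ, 0 < N ∧ ∀ n ≥ N, ∀ x : X,
      (1 / (n : ℝ)) * ∑ i ∈ Finset.range n, φ (f^[i] x) < lam := by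
  by_contra! hcon
  choose m hm x hx using fun k : ℕ ↦ hcon (k + 1) k.succ_pos
  let l : Ultrafilter ℕ := hyperfilter ℕ
  obtain ⟨μ, -, hμ⟩ := isCompact_univ.ultrafilter_le_nhds
    (l.map fun k ↦ orbitMeasure f (m k - 1) (x k)) (by simp)
  replace hμ : Tendsto (fun k ↦ orbitMeasure f (m k - 1) (x k)) l (𝓝 μ) := hμ
  have hn : Tendsto (fun k ↦ m k - 1) l atTop :=
    (tendsto_atTop_mono (fun k ↦ Nat.le_sub_of_add_le (hm k)) tendsto_id).mono_left
      Nat.hyperfilter_le_atTop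
  refine (h μ inferInstance (map_eq_of_tendsto_orbitMeasure hf hn hμ)).not_ge ?_
  let g : X →ᵇ ℝ := BoundedContinuousFunction.mkOfCompact ⟨φ, hφ⟩
  refine ge_of_tendsto' (ProbabilityMeasure.tendsto_iff_forall_integral_tendsto.1 hμ g) fun k ↦ ?_
  rw [integral_orbitMeasure, Nat.sub_add_cancel (le_trans (by simp) (hm k))]
  simpa [birkhoffAverage, birkhoffSum, g] using hx k
end

section
/- Let X be a compact metric space, f : X → X a homeomorphism, m a Borel measure on X positive on every nonempty open set, ρ : X → [0,∞) continuous, and ν := m.withDensity ρ a Borel measure that is f-invariant (f_*ν = ν). Suppose U ⊆ X is a nonempty open set with ν(U) = 0. Then, setting H₀ := ρ⁻¹({0}) and Λ := ⋂_{n ∈ ℤ} f^{-n}(H₀), the set Λ is a nonempty compact set satisfying f(Λ) = Λ and U ⊆ Λ. -/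
open MeasureTheory

/-- An open set that is null for a measure with continuous density, relative to a measure that is
positive on nonempty open sets, is contained in the zero set of the density. -/
theorem IsOpen.subset_zeros_of_withDensity_eq_zero {X : Type*} [TopologicalSpace X]
    [MeasurableSpace X] [BorelSpace X] {m : Measure X}
    (hm : ∀ V : Set X, IsOpen V → V.Nonempty → 0 < m V)
    {ρ : X → NNReal} (hρ : Continuous ρ) {V : Set X} (hV : IsOpen V)
    (hV0 : m.withDensity (fun x => (ρ x : ENNReal)) V = 0) : V ⊆ ρ ⁻¹' {0} := by
  rw [withDensity_apply_eq_zero hρ.measurable.coe_nnreal_ennreal] at hV0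
  intro x hx
  by_contra hne
  refine (hm _ ((isOpen_ne_fun hρ continuous_const).inter hV) ⟨x, hne, hx⟩).ne' ?_
  simpa only [ne_eq, ENNReal.coe_eq_zero] using hV0

/-- The integer iterates of a measure-preserving homeomorphism send null open sets to
null open sets. -/
theorem Homeomorph.isOpen_and_null_zpow_image {X : Type*} [TopologicalSpace X]
    [MeasurableSpace X] [BorelSpace X] (f : X ≃ₜ X) {ν : Measure X}
    (hinv : Measure.map f ν = ν) (n : ℤ) {V : Set X} (hV : IsOpen V) (hV0 : ν V = 0) :
    IsOpen (⇑(f.toEquiv ^ n) '' V) ∧ ν (⇑(f.toEquiv ^ n) '' V) = 0 := by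
  have hpre (W : Set X) : ν (f ⁻¹' W) = ν W := by
    conv_rhs => rw [← hinv]
    exact (f.toMeasurableEquiv.map_apply W).symm
  induction n with
  | zero => simpa using ⟨hV, hV0⟩
  | succ n ih =>
    have h : ⇑(f.toEquiv ^ ((n : ℤ) + 1)) '' V = f '' (⇑(f.toEquiv ^ (n : ℤ)) '' V) := by
      rw [add_comm, zpow_one_add, Equiv.Perm.coe_mul, Set.image_comp]
      rfl
    rw [h, ← hpre, f.injective.preimage_image]
    exact ⟨f.isOpenMap _ ih.1, ih.2⟩
  | pred n ih =>
    have h : ⇑(f.toEquiv ^ (-(n : ℤ) - 1)) '' V = f ⁻¹' (⇑(f.toEquiv ^ (-(n : ℤ))) '' V) := by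
      rw [sub_eq_neg_add, zpow_add, zpow_neg_one, Equiv.Perm.coe_mul, Set.image_comp]
      exact f.toEquiv.image_symm_eq_preimage _
    rw [h, hpre]
    exact ⟨ih.1.preimage f.continuous, ih.2⟩

/-- The integer iterates of a homeomorphism are continuous. -/
theorem Homeomorph.continuous_toEquiv_zpow {X : Type*} [TopologicalSpace X] (f : X ≃ₜ X)
    (n : ℤ) : Continuous ⇑(f.toEquiv ^ n) := by
  induction n with
  | zero => simpa using continuous_id
  | succ n ih =>
    rw [zpow_add_one, Equiv.Perm.coe_mul]
    exact ih.comp f.continuous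
  | pred n ih =>
    rw [zpow_sub_one, Equiv.Perm.coe_mul]
    exact ih.comp f.symm.continuous

/-- If a homeomorphism `f` of a compact metric space preserves a measure
`ν = m.withDensity ρ` with continuous density `ρ` with respect to a measure `m`
positive on nonempty open sets, and `ν` vanishes on a nonempty open set `U`,
then `Λ = ⋂_{n ∈ ℤ} f^{-n}(ρ⁻¹{0})` is a nonempty compact `f`-invariant set
containing `U`. -/
theorem stmt_9 {X : Type*} [MetricSpace X] [CompactSpace X]
    [MeasurableSpace X] [BorelSpace X]
    (f : X ≃ₜ X)
    (m : Measure X)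
    (hm : ∀ V : Set X, IsOpen V → V.Nonempty → 0 < m V)
    (ρ : X → NNReal) (hρ : Continuous ρ)
    (ν : Measure X) (hν : ν = m.withDensity fun x => (ρ x : ENNReal))
    (hinv : Measure.map f ν = ν)
    (U : Set X) (hUopen : IsOpen U) (hUne : U.Nonempty) (hU0 : ν U = 0)
    (H₀ : Set X) (hH₀ : H₀ = ρ ⁻¹' {0})
    (Λ : Set X) (hΛ : Λ = ⋂ n : ℤ, (⇑(f.toEquiv ^ n)) ⁻¹' H₀) :
    Λ.Nonempty ∧ IsCompact Λ ∧ f '' Λ = Λ ∧ U ⊆ Λ := by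
  subst hν hH₀ hΛ
  have hU : U ⊆ ⋂ n : ℤ, (⇑(f.toEquiv ^ n)) ⁻¹' (ρ ⁻¹' {0}) := by
    refine Set.subset_iInter fun n => Set.image_subset_iff.1 ?_
    obtain ⟨ho, h0⟩ := f.isOpen_and_null_zpow_image hinv n hUopen hU0
    exact ho.subset_zeros_of_withDensity_eq_zero hm hρ h0
  refine ⟨hUne.mono hU, ?_, ?_, hU⟩
  · exact (isClosed_iInter fun n =>
      (isClosed_singleton.preimage hρ).preimage (f.continuous_toEquiv_zpow n)).isCompact
  · rw [Set.image_eq_preimage_of_inverse f.symm_apply_apply f.apply_symm_apply,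
      Set.preimage_iInter]
    refine (Equiv.subRight (1 : ℤ)).surjective.iInf_congr _ fun n => ?_
    rw [Equiv.subRight_apply, zpow_sub_one, Equiv.Perm.coe_mul, Set.preimage_comp]
    rfl
end
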